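/- arXiv:0804.3134 — 3 statements merged into one kernel-verified Lean document; each statement's English description precedes it below -/
import Mathlib

section
/- For every integer g ≥ 3 and every odd integer N ≥ 1, the first group cohomology H¹(Sp_{2g}(ℤ/Nℤ), sp_{2g}(ℤ/Nℤ)) vanishes, where Sp_{2g}(ℤ/Nℤ) acts on sp_{2g}(ℤ/Nℤ) by the adjoint action (conjugation). -/
open Matrix

/-- The paper's standard symplectic form matrix `J = [[0, 1_g], [-1_g, 0]]`. -/
def paperJ (l R : Type*) [DecidableEq l] [CommRing R] : Matrix (l ⊕ l) (l ⊕ l) R :=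
  Matrix.fromBlocks 0 1 (-1) 0

/-- The paper's symplectic condition `ᵀM·J·M = J` (with `J = [[0, 1_g], [-1_g, 0]]`)
characterizes membership in Mathlib's `Matrix.symplecticGroup`; hence the latter *is* the
symplectic group `Sp_{2g}(R)` of the paper. -/
theorem mem_symplecticGroup_iff_paper {l R : Type*} [DecidableEq l] [Fintype l] [CommRing R]
    (M : Matrix (l ⊕ l) (l ⊕ l) R) :
    M ∈ Matrix.symplecticGroup l R ↔ Mᵀ * paperJ l R * M = paperJ l R := by
  have hJ : paperJ l R = -(Matrix.J l R) := by
    rw [paperJ, Matrix.J, Matrix.fromBlocks_neg]; norm_num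
  rw [SymplecticGroup.mem_iff', hJ]
  constructor
  · intro h; rw [Matrix.mul_neg, Matrix.neg_mul, h]
  · intro h
    have := congrArg Neg.neg h
    simpa [Matrix.mul_neg, Matrix.neg_mul] using this

/-- The Lie algebra `sp_{2g}(R)`: the `R`-module of matrices `X` with `ᵀX·J + J·X = 0`. -/
def spLie (l R : Type*) [DecidableEq l] [Fintype l] [CommRing R] :
    Submodule R (Matrix (l ⊕ l) (l ⊕ l) R) where
  carrier := {X | Xᵀ * paperJ l R + paperJ l R * X = 0}
  add_mem' := by
    intro a b ha hb
    simp only [Set.mem_setOf_eq] at *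
    rw [Matrix.transpose_add, Matrix.add_mul, Matrix.mul_add]
    calc aᵀ * paperJ l R + bᵀ * paperJ l R + (paperJ l R * a + paperJ l R * b)
        = (aᵀ * paperJ l R + paperJ l R * a) + (bᵀ * paperJ l R + paperJ l R * b) := by abel
      _ = 0 := by rw [ha, hb, add_zero]
  zero_mem' := by simp
  smul_mem' := by
    intro c x hx
    simp only [Set.mem_setOf_eq] at *
    rw [Matrix.transpose_smul, Matrix.smul_mul, Matrix.mul_smul, ← smul_add, hx, smul_zero]

namespace SpCohomology

open Sum

variable {l R : Type*} [DecidableEq l] [CommRing R]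

/-- The bilinear form with Gram matrix `S`. -/
def bil {m : Type*} [Fintype m] (S : Matrix m m R) (p q : m → R) : R := p ⬝ᵥ S *ᵥ q

section bil

variable {m : Type*} [Fintype m] (S : Matrix m m R) (p p' q q' : m → R) (r : R)

@[simp] lemma bil_add_left : bil S (p + p') q = bil S p q + bil S p' q := by
  simp [bil, add_dotProduct]

@[simp] lemma bil_add_right : bil S p (q + q') = bil S p q + bil S p q' := by
  simp [bil, mulVec_add, dotProduct_add]

@[simp] lemma bil_sub_left : bil S (p - p') q = bil S p q - bil S p' q := by
  simp [bil, sub_dotProduct]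

@[simp] lemma bil_sub_right : bil S p (q - q') = bil S p q - bil S p q' := by
  simp [bil, mulVec_sub, dotProduct_sub]

@[simp] lemma bil_neg_left : bil S (-p) q = -bil S p q := by
  simp [bil]

@[simp] lemma bil_neg_right : bil S p (-q) = -bil S p q := by
  simp [bil, mulVec_neg]

@[simp] lemma bil_smul_left : bil S (r • p) q = r * bil S p q := by
  simp [bil]

@[simp] lemma bil_smul_right : bil S p (r • q) = r * bil S p q := by
  simp [bil, mulVec_smul]

@[simp] lemma bil_zero : bil (0 : Matrix m m R) p q = 0 := by
  simp [bil]

@[simp] lemma bil_single_single [DecidableEq m] (x y : m) :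
    bil S (Pi.single x 1) (Pi.single y 1) = S x y := by
  simp [bil]

lemma congr_apply (M : Matrix m m R) (x y : m) :
    (M * S * Mᵀ) x y = bil S (M x) (M y) := by
  rw [Matrix.mul_assoc, bil, Matrix.mul_apply, dotProduct]
  refine Finset.sum_congr rfl fun z _ => ?_
  rw [Matrix.mul_apply, mulVec, dotProduct]
  rfl

lemma ext_rows {m R : Type*} {M N : Matrix m m R} (h : ∀ x, M x = N x) : M = N := funext h

lemma one_row {m : Type*} [DecidableEq m] (x : m) : (1 : Matrix m m R) x = Pi.single x 1 := by
  ext y; simp [Matrix.one_apply, Pi.single_apply, eq_comm]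

lemma mul_row (M N : Matrix m m R) (x : m) : (M * N) x = M x ᵥ* N := by
  ext y; rfl

@[simp] lemma row_eq {m R : Type*} (N : Matrix m m R) (x : m) : N.row x = N x := rfl

end bil

@[simp] lemma J_inl_inl (i j : l) : J l R (inl i) (inl j) = 0 := rfl
@[simp] lemma J_inr_inr (i j : l) : J l R (inr i) (inr j) = 0 := rfl
@[simp] lemma J_inl_inr (i j : l) : J l R (inl i) (inr j) = if i = j then -1 else 0 := by
  by_cases h : i = j <;> simp [J, h]
@[simp] lemma J_inr_inl (i j : l) : J l R (inr i) (inl j) = if i = j then 1 else 0 := by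
  by_cases h : i = j <;> simp [J, h]

variable [Fintype l]

lemma mem_of_rows {M : Matrix (l ⊕ l) (l ⊕ l) R}
    (h : ∀ x y, bil (J l R) (M x) (M y) = J l R x y) : M ∈ symplecticGroup l R := by
  rw [SymplecticGroup.mem_iff]
  ext x y
  rw [congr_apply, h]

/-- The long root element `f_i ↦ f_i + e_i`. -/
def longUpper (i : l) : symplecticGroup l R :=
  ⟨fun x => if x = inl i then Pi.single (inl i) 1 + Pi.single (inr i) 1 else Pi.single x 1, by
    apply mem_of_rows
    rintro (x | x) (y | y) <;> by_cases hx : x = i <;> by_cases hy : y = i <;>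
      simp_all [eq_comm]⟩

/-- The long root element `e_i ↦ e_i - f_i`. -/
def longLower (i : l) : symplecticGroup l R :=
  ⟨fun x => if x = inr i then Pi.single (inr i) 1 - Pi.single (inl i) 1 else Pi.single x 1, by
    apply mem_of_rows
    rintro (x | x) (y | y) <;> by_cases hx : x = i <;> by_cases hy : y = i <;>
      simp_all [eq_comm]⟩

/-- The short root element `e_j ↦ e_j + e_i`, `f_i ↦ f_i - f_j`. -/
def short (i j : l) (hij : i ≠ j) : symplecticGroup l R :=
  ⟨fun x => if x = inl i then Pi.single (inl i) 1 + Pi.single (inl j) 1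
      else if x = inr j then Pi.single (inr j) 1 - Pi.single (inr i) 1 else Pi.single x 1, by
    apply mem_of_rows
    have hji := hij.symm
    rintro (x | x) (y | y) <;> by_cases hx : x = i <;> by_cases hy : y = i <;>
      by_cases hx' : x = j <;> by_cases hy' : y = j <;>
      simp_all [eq_comm]⟩

/-- The transvection along `e_i + e_j`. -/
def sumTransvection (i j : l) (hij : i ≠ j) : symplecticGroup l R :=
  ⟨fun x => if x = inl i then Pi.single (inl i) 1 + Pi.single (inr i) 1 + Pi.single (inr j) 1
      else if x = inl j then Pi.single (inl j) 1 + Pi.single (inr i) 1 + Pi.single (inr j) 1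
      else Pi.single x 1, by
    apply mem_of_rows
    have hji := hij.symm
    rintro (x | x) (y | y) <;> by_cases hx : x = i <;> by_cases hy : y = i <;>
      by_cases hx' : x = j <;> by_cases hy' : y = j <;>
      simp_all [eq_comm]⟩

/-- The cosine of a quarter turn. -/
def quarterCos : ZMod 4 → ℤ := ![1, 0, -1, 0]

/-- The sine of a quarter turn. -/
def quarterSin : ZMod 4 → ℤ := ![0, 1, 0, -1]

lemma quarterCos_add : ∀ a b, quarterCos (a + b) =
    quarterCos a * quarterCos b - quarterSin a * quarterSin b := by decide

lemma quarterSin_add : ∀ a b, quarterSin (a + b) =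
    quarterSin a * quarterCos b + quarterCos a * quarterSin b := by decide

lemma quarter_sq : ∀ a, quarterCos a * quarterCos a + quarterSin a * quarterSin a = 1 := by
  decide

/-- The matrix rotating the planes `⟨e_i, f_i⟩` simultaneously by quarter turns. -/
def rotationMatrix (z : l → ZMod 4) : Matrix (l ⊕ l) (l ⊕ l) R := fun x => Sum.elim
  (fun i => (quarterCos (z i) : R) • Pi.single (inl i) 1
    + (quarterSin (z i) : R) • Pi.single (inr i) 1)
  (fun i => (quarterCos (z i) : R) • Pi.single (inr i) 1
    - (quarterSin (z i) : R) • Pi.single (inl i) 1) x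

lemma rotationMatrix_inl (z : l → ZMod 4) (i : l) :
    (rotationMatrix z : Matrix _ _ R) (inl i) = (quarterCos (z i) : R) • Pi.single (inl i) 1
    + (quarterSin (z i) : R) • Pi.single (inr i) 1 := rfl

lemma rotationMatrix_inr (z : l → ZMod 4) (i : l) :
    (rotationMatrix z : Matrix _ _ R) (inr i) = (quarterCos (z i) : R) • Pi.single (inr i) 1
    - (quarterSin (z i) : R) • Pi.single (inl i) 1 := rfl

lemma rotationMatrix_mem (z : l → ZMod 4) :
    (rotationMatrix z : Matrix _ _ R) ∈ symplecticGroup l R := by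
  apply mem_of_rows
  have key (i : l) := congrArg (Int.cast : ℤ → R) (quarter_sq (z i))
  push_cast at key
  rintro (x | x) (y | y) <;> by_cases hxy : x = y <;>
    simp_all [eq_comm, rotationMatrix_inl, rotationMatrix_inr]
  · ring
  · linear_combination -key y
  · linear_combination key y
  · ring

lemma rotationMatrix_add (z z' : l → ZMod 4) :
    (rotationMatrix (z + z') : Matrix _ _ R) = rotationMatrix z * rotationMatrix z' := by
  refine ext_rows fun x => ?_
  rw [mul_row]
  rcases x with x | x <;>
  simp only [rotationMatrix_inl, rotationMatrix_inr, quarterCos_add, quarterSin_add, add_vecMul,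
    sub_vecMul, smul_vecMul, Pi.add_apply, single_one_vecMul, row_eq, Int.cast_add, Int.cast_sub,
    Int.cast_mul] <;> module

/-- The simultaneous rotations of the planes `⟨e_i, f_i⟩` by quarter turns. -/
def rotation : Multiplicative (l → ZMod 4) →* symplecticGroup l R where
  toFun z := ⟨rotationMatrix z.toAdd, rotationMatrix_mem _⟩
  map_one' := by
    have h0 : quarterCos 0 = 1 := rfl
    have h1 : quarterSin 0 = 0 := rfl
    refine Subtype.ext (ext_rows ?_)
    rintro (x | x) <;> ext y <;>
      simp [rotationMatrix_inl, rotationMatrix_inr, h0, h1, Matrix.one_apply, Pi.single_apply,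
        eq_comm]
  map_mul' z z' := Subtype.ext (rotationMatrix_add _ _)

/-- The rotation of the plane `⟨e_k, f_k⟩` by a quarter turn. -/
def weyl (k : l) : symplecticGroup l R := rotation (Multiplicative.ofAdd (Pi.single k 1))

/-- The rotation of the plane `⟨e_k, f_k⟩` by a half turn. -/
def halfTurn (k : l) : symplecticGroup l R := rotation (Multiplicative.ofAdd (Pi.single k 2))

lemma longUpper_row (i : l) (x : l ⊕ l) : (longUpper i : symplecticGroup l R).1 x =
    if x = inl i then Pi.single (inl i) 1 + Pi.single (inr i) 1 else Pi.single x 1 := rfl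

lemma longLower_row (i : l) (x : l ⊕ l) : (longLower i : symplecticGroup l R).1 x =
    if x = inr i then Pi.single (inr i) 1 - Pi.single (inl i) 1 else Pi.single x 1 := rfl

lemma short_row (i j : l) (hij : i ≠ j) (x : l ⊕ l) : (short i j hij : symplecticGroup l R).1 x =
    if x = inl i then Pi.single (inl i) 1 + Pi.single (inl j) 1
      else if x = inr j then Pi.single (inr j) 1 - Pi.single (inr i) 1 else Pi.single x 1 := rfl

lemma sumTransvection_row (i j : l) (hij : i ≠ j) (x : l ⊕ l) :
    (sumTransvection i j hij : symplecticGroup l R).1 x =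
    if x = inl i then Pi.single (inl i) 1 + Pi.single (inr i) 1 + Pi.single (inr j) 1
      else if x = inl j then Pi.single (inl j) 1 + Pi.single (inr i) 1 + Pi.single (inr j) 1
      else Pi.single x 1 := rfl

lemma weyl_row (k : l) (x : l ⊕ l) : (weyl k : symplecticGroup l R).1 x =
    if x = inl k then Pi.single (inr k) 1 else if x = inr k then -Pi.single (inl k) 1
      else Pi.single x 1 := by
  have h0 : quarterCos 0 = 1 := rfl
  have h1 : quarterSin 0 = 0 := rfl
  have h2 : quarterCos 1 = 0 := rfl
  have h3 : quarterSin 1 = 1 := rfl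
  change rotationMatrix (Pi.single k 1) x = _
  rcases x with x | x <;> by_cases h : x = k <;>
    simp [rotationMatrix_inl, rotationMatrix_inr, h, h0, h1, h2, h3]

lemma halfTurn_row (k : l) (x : l ⊕ l) : (halfTurn k : symplecticGroup l R).1 x =
    if x = inl k ∨ x = inr k then -Pi.single x 1 else Pi.single x 1 := by
  have h0 : quarterCos 0 = 1 := rfl
  have h1 : quarterSin 0 = 0 := rfl
  have h2 : quarterCos 2 = -1 := rfl
  have h3 : quarterSin 2 = 0 := rfl
  change rotationMatrix (Pi.single k 2) x = _
  rcases x with x | x <;> by_cases h : x = k <;>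
    simp [rotationMatrix_inl, rotationMatrix_inr, h, h0, h1, h2, h3]

section relations

lemma ext_mul {a b a' b' : symplecticGroup l R}
    (h : ∀ x, a.1 x ᵥ* b.1 = a'.1 x ᵥ* b'.1) : a * b = a' * b' :=
  Subtype.ext (ext_rows fun x => by simpa [mul_row] using h x)

variable (i j k : l)

lemma longUpper_comm (hik : i ≠ k) :
    (longUpper i * longUpper k : symplecticGroup l R) = longUpper k * longUpper i := by
  have hki := hik.symm
  apply ext_mul
  rintro (x | x) <;> by_cases hi : x = i <;> by_cases hk : x = k <;>
    simp_all [longUpper_row, add_vecMul]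

lemma longUpper_weyl_comm (hik : i ≠ k) :
    (longUpper i * weyl k : symplecticGroup l R) = weyl k * longUpper i := by
  have hki := hik.symm
  apply ext_mul
  rintro (x | x) <;> by_cases hi : x = i <;> by_cases hk : x = k <;>
    simp_all [longUpper_row, weyl_row, add_vecMul, neg_vecMul]

lemma longUpper_halfTurn_comm :
    (longUpper i * halfTurn k : symplecticGroup l R) = halfTurn k * longUpper i := by
  apply ext_mul
  rintro (x | x) <;> by_cases hi : x = i <;> by_cases hk : x = k <;> by_cases hik : i = k <;>
    simp_all [longUpper_row, halfTurn_row, add_vecMul, neg_vecMul]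
  all_goals abel

lemma weyl_longUpper :
    (weyl i * longUpper i : symplecticGroup l R) = longLower i * weyl i := by
  apply ext_mul
  rintro (x | x) <;> by_cases hi : x = i <;>
    simp_all [longUpper_row, longLower_row, weyl_row, sub_vecMul, neg_vecMul]
  all_goals abel

lemma longUpper_weyl_sq_row (x : l ⊕ l) :
    (longUpper i * weyl i * (longUpper i * weyl i) : symplecticGroup l R).1 x =
    if x = inl i then -Pi.single (inr i) 1 else if x = inr i then
      Pi.single (inl i) 1 - Pi.single (inr i) 1 else Pi.single x 1 := by
  rcases x with x | x <;> by_cases hi : x = i <;>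
    simp_all [mul_row, longUpper_row, weyl_row, add_vecMul, neg_vecMul]
  abel

lemma longUpper_weyl_cube : (longUpper i * weyl i * (longUpper i * weyl i) : symplecticGroup l R) *
    (longUpper i * weyl i) = 1 := by
  refine Subtype.ext (ext_rows fun x => ?_)
  rw [Submonoid.coe_mul, mul_row, longUpper_weyl_sq_row]
  rcases x with x | x <;> by_cases hi : x = i <;>
    simp_all [mul_row, longUpper_row, weyl_row, add_vecMul, sub_vecMul, neg_vecMul, one_row]

lemma longUpper_short_comm (hij : i ≠ j) :
    (longUpper i * short i j hij : symplecticGroup l R) = short i j hij * longUpper i := by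
  have hji := hij.symm
  apply ext_mul
  rintro (x | x) <;> by_cases hi : x = i <;> by_cases hj : x = j <;>
    simp_all [longUpper_row, short_row, add_vecMul, sub_vecMul]
  all_goals abel

lemma longLower_short_comm (hij : i ≠ j) :
    (longLower j * short i j hij : symplecticGroup l R) = short i j hij * longLower j := by
  have hji := hij.symm
  apply ext_mul
  rintro (x | x) <;> by_cases hi : x = i <;> by_cases hj : x = j <;>
    simp_all [longLower_row, short_row, add_vecMul, sub_vecMul]
  all_goals abel

lemma longUpper_short_comm_of_ne (hij : i ≠ j) (hki : k ≠ i) (hkj : k ≠ j) :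
    (longUpper k * short i j hij : symplecticGroup l R) = short i j hij * longUpper k := by
  have hji := hij.symm
  apply ext_mul
  rintro (x | x) <;> by_cases hi : x = i <;> by_cases hj : x = j <;> by_cases hk : x = k <;>
    simp_all [longUpper_row, short_row, add_vecMul, sub_vecMul, hki.symm, hkj.symm]

lemma longLower_short_comm_of_ne (hij : i ≠ j) (hki : k ≠ i) (hkj : k ≠ j) :
    (longLower k * short i j hij : symplecticGroup l R) = short i j hij * longLower k := by
  have hji := hij.symm
  apply ext_mul
  rintro (x | x) <;> by_cases hi : x = i <;> by_cases hj : x = j <;> by_cases hk : x = k <;>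
    simp_all [longLower_row, short_row, add_vecMul, sub_vecMul, hki.symm, hkj.symm]

lemma short_halfTurn_short (hij : i ≠ j) :
    (short i j hij * halfTurn i * short i j hij : symplecticGroup l R) = halfTurn i := by
  have hji := hij.symm
  refine Subtype.ext (ext_rows ?_)
  rintro (x | x) <;> by_cases hi : x = i <;> by_cases hj : x = j <;>
    simp_all [mul_row, halfTurn_row, short_row, add_vecMul, sub_vecMul, neg_vecMul]

lemma sumTransvection_mul_short (hij : i ≠ j) :
    (sumTransvection i j hij * short i j hij : symplecticGroup l R) =
      short i j hij * longUpper j := by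
  have hji := hij.symm
  apply ext_mul
  rintro (x | x) <;> by_cases hi : x = i <;> by_cases hj : x = j <;>
    simp_all [longUpper_row, short_row, sumTransvection_row, add_vecMul, sub_vecMul]
  all_goals abel

lemma sumTransvection_comm (hij : i ≠ j) :
    (sumTransvection i j hij : symplecticGroup l R) = sumTransvection j i hij.symm := by
  have hji := hij.symm
  refine Subtype.ext (ext_rows ?_)
  rintro (x | x) <;> by_cases hi : x = i <;> by_cases hj : x = j <;>
    simp_all [sumTransvection_row]
  all_goals abel

end relations

/-- A `1`-cocycle on the symplectic group with values in symmetric matrices, on which the group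
acts by congruence. -/
structure IsCocycle (d : symplecticGroup l R → Matrix (l ⊕ l) (l ⊕ l) R) : Prop where
  symm : ∀ u, (d u).IsSymm
  mul : ∀ u v, d (u * v) = d u + u.1 * d v * u.1ᵀ

namespace IsCocycle

variable {d : symplecticGroup l R → Matrix (l ⊕ l) (l ⊕ l) R}

lemma apply_comm (hd : IsCocycle d) (u : symplecticGroup l R) (x y : l ⊕ l) :
    d u x y = d u y x := (hd.symm u).apply y x

lemma mul_apply (hd : IsCocycle d) (u v : symplecticGroup l R) (x y : l ⊕ l) :
    d (u * v) x y = d u x y + bil (d v) (u.1 x) (u.1 y) := by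
  rw [hd.mul, Matrix.add_apply, congr_apply]

lemma one (hd : IsCocycle d) : d 1 = 0 := by
  have := hd.mul 1 1
  simpa using this

lemma sub_coboundary (hd : IsCocycle d) {X : Matrix (l ⊕ l) (l ⊕ l) R} (hX : X.IsSymm) :
    IsCocycle fun u => d u - (u.1 * X * u.1ᵀ - X) where
  symm u := by
    refine (hd.symm u).sub (IsSymm.sub ?_ hX)
    rw [IsSymm, transpose_mul, transpose_mul, transpose_transpose, hX.eq, Matrix.mul_assoc]
  mul u v := by
    rw [hd.mul]
    simp only [Submonoid.coe_mul, transpose_mul, Matrix.mul_sub, Matrix.sub_mul, Matrix.mul_assoc]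
    abel

/-- The subgroup on which a cocycle vanishes. -/
def ker (hd : IsCocycle d) : Subgroup (symplecticGroup l R) where
  carrier := {u | d u = 0}
  one_mem' := hd.one
  mul_mem' {u v} hu hv := by
    change d (u * v) = 0
    rw [hd.mul, show d u = 0 from hu, show d v = 0 from hv]
    simp
  inv_mem' {u} hu := by
    change d u⁻¹ = 0
    have h := hd.mul u⁻¹ u
    rw [inv_mul_cancel, hd.one, show d u = 0 from hu] at h
    simpa using h.symm

lemma mem_ker (hd : IsCocycle d) {u : symplecticGroup l R} : u ∈ hd.ker ↔ d u = 0 := Iff.rfl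

/-- If `k u = u k'` with `k`, `k'` in the kernel, then `d u` is fixed by `k`. -/
lemma bil_eq_of_mul_eq (hd : IsCocycle d) {k k' u : symplecticGroup l R} (hk : d k = 0)
    (hk' : d k' = 0) (h : k * u = u * k') (x y : l ⊕ l) :
    bil (d u) (k.1 x) (k.1 y) = d u x y := by
  have := congrArg (fun v => d v x y) h
  simpa [hd.mul_apply, hk, hk', bil] using this

/-- A cocycle is a coboundary on the image of a finite group of invertible order. -/
lemma exists_coboundary_of_finite (hd : IsCocycle d) {G : Type*} [Group G] [Fintype G]
    (hG : IsUnit (Fintype.card G : R)) (ρ : G →* symplecticGroup l R) :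
    ∃ X : Matrix (l ⊕ l) (l ⊕ l) R, X.IsSymm ∧
      ∀ z, d (ρ z) = (ρ z).1 * X * (ρ z).1ᵀ - X := by
  obtain ⟨r, hr⟩ := hG.exists_left_inv
  refine ⟨-(r • ∑ z, d (ρ z)), ?_, fun z => ?_⟩
  · simp only [IsSymm, transpose_neg, transpose_smul, transpose_sum, (hd.symm _).eq]
  · have h : ∑ y, d (ρ y) = (Fintype.card G : R) • d (ρ z) +
        (ρ z).1 * (∑ y, d (ρ y)) * (ρ z).1ᵀ := by
      conv_lhs => rw [← Equiv.sum_comp (Equiv.mulLeft z) (fun y => d (ρ y))]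
      simp only [Equiv.coe_mulLeft, map_mul, hd.mul, Finset.sum_add_distrib, Finset.sum_const,
        Matrix.mul_sum, Matrix.sum_mul, Finset.card_univ, Nat.cast_smul_eq_nsmul]
    have h' := congrArg (r • ·) h
    simp only [smul_add, smul_smul, hr, one_smul] at h'
    simp only [Matrix.mul_neg, Matrix.neg_mul, Matrix.mul_smul, Matrix.smul_mul]
    rw [h']
    abel

end IsCocycle

/-- The part of a fixed matrix annihilated by one upper long root element. -/
lemma row_inr_eq_zero (h2 : IsUnit (2 : R)) {S : Matrix (l ⊕ l) (l ⊕ l) R} (hS : S.IsSymm) (i : l)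
    (hU : ∀ x y, bil S ((longUpper i : symplecticGroup l R).1 x)
      ((longUpper i : symplecticGroup l R).1 y) = S x y) (y : l ⊕ l) : S (inr i) y = 0 := by
  have hsymm := hS.apply
  have hne (y : l ⊕ l) (hy : y ≠ inl i) : S (inr i) y = 0 := by
    simpa [longUpper_row, hy] using hU (inl i) y
  by_cases hy : y = inl i
  · subst hy
    have h := hU (inl i) (inl i)
    simp only [longUpper_row, if_true, bil_add_left, bil_add_right, bil_single_single,
      hne (inr i) (by simp), hsymm (inl i) (inr i)] at h
    refine h2.mul_left_cancel ?_
    linear_combination h - 2 * hsymm (inr i) (inl i)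
  · exact hne y hy

lemma row_inl_eq_zero (h2 : IsUnit (2 : R)) {S : Matrix (l ⊕ l) (l ⊕ l) R} (hS : S.IsSymm) (i : l)
    (hL : ∀ x y, bil S ((longLower i : symplecticGroup l R).1 x)
      ((longLower i : symplecticGroup l R).1 y) = S x y) (y : l ⊕ l) : S (inl i) y = 0 := by
  have hsymm := hS.apply
  have hne (y : l ⊕ l) (hy : y ≠ inr i) : S (inl i) y = 0 := by
    simpa [longLower_row, hy] using hL (inr i) y
  by_cases hy : y = inr i
  · subst hy
    have h := hL (inr i) (inr i)
    simp only [longLower_row, if_true, bil_sub_left, bil_sub_right, bil_single_single,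
      hne (inl i) (by simp)] at h
    refine h2.mul_left_cancel ?_
    linear_combination -h + hsymm (inr i) (inl i)
  · exact hne y hy

/-- A symmetric matrix fixed by the long root elements vanishes. -/
lemma eq_zero_of_long_fixed (h2 : IsUnit (2 : R)) {S : Matrix (l ⊕ l) (l ⊕ l) R} (hS : S.IsSymm)
    (hU : ∀ i x y, bil S ((longUpper i : symplecticGroup l R).1 x)
      ((longUpper i : symplecticGroup l R).1 y) = S x y)
    (hL : ∀ i x y, bil S ((longLower i : symplecticGroup l R).1 x)
      ((longLower i : symplecticGroup l R).1 y) = S x y) : S = 0 := by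
  ext (i | i) y
  · exact row_inl_eq_zero h2 hS i (hL i) y
  · exact row_inr_eq_zero h2 hS i (hU i) y

namespace IsCocycle

variable {d : symplecticGroup l R → Matrix (l ⊕ l) (l ⊕ l) R}

section normalized

variable (hd : IsCocycle d) (h2 : IsUnit (2 : R)) (hrot : ∀ z, d (rotation z) = 0)

include hd h2 hrot

lemma longUpper_apply_of_block_ne {i k : l} {x y : l ⊕ l} (hx : x = inl k ∨ x = inr k)
    (hy : ¬(y = inl k ∨ y = inr k)) : d (longUpper i) x y = 0 := by
  have h := hd.bil_eq_of_mul_eq (hrot _) (hrot _) (longUpper_halfTurn_comm (R := R) i k).symm x y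
  change bil _ ((halfTurn k).1 x) ((halfTurn k).1 y) = _ at h
  simp only [halfTurn_row, hx, hy, if_true, if_false, bil_neg_left, bil_single_single] at h
  refine h2.mul_left_cancel ?_
  linear_combination -h

lemma longUpper_apply_of_ne {i k : l} (hik : i ≠ k) {x : l ⊕ l} (hx : x = inl k ∨ x = inr k)
    (y : l ⊕ l) : d (longUpper i) x y = 0 := by
  by_cases hy : ¬(y = inl k ∨ y = inr k)
  · exact hd.longUpper_apply_of_block_ne h2 hrot hx hy
  have h (x y) := hd.bil_eq_of_mul_eq (hrot _) (hrot _)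
    (longUpper_weyl_comm (R := R) i k hik).symm x y
  change ∀ x y, bil _ ((weyl k).1 x) ((weyl k).1 y) = _ at h
  have hoff : d (longUpper i) (inl k) (inr k) = 0 := by
    have h1 := h (inl k) (inr k)
    simp [weyl_row] at h1
    refine h2.mul_left_cancel ?_
    linear_combination -h1 - hd.apply_comm (longUpper i) (inr k) (inl k)
  have hdiag : d (longUpper i) (inr k) (inr k) = d (longUpper i) (inl k) (inl k) := by
    simpa [weyl_row] using h (inl k) (inl k)
  have hcomm := congrArg (fun v => d v (inl k) (inl k)) (longUpper_comm (R := R) i k hik)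
  simp [hd.mul_apply, longUpper_row, hik.symm, hoff, hd.apply_comm _ (inr k) (inl k)] at hcomm
  have hzero : d (longUpper i) (inl k) (inl k) = 0 := by
    linear_combination -hcomm - hdiag
  rcases hx with rfl | rfl <;> rcases not_not.mp hy with rfl | rfl <;>
    simp_all [hd.apply_comm _ (inr k) (inl k)]

lemma longUpper_apply_inr {i j : l} (hij : i ≠ j) : d (longUpper i) (inr i) (inr i) = 0 := by
  have h := congrArg (fun v => d v (inr j) (inr j)) (longUpper_short_comm (R := R) i j hij)
  have h0 := hd.longUpper_apply_of_ne h2 hrot hij (Or.inr rfl)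
  simpa [hd.mul_apply, longUpper_row, short_row, hij, h0, hd.apply_comm _ (inr i) (inr j)] using h

lemma longUpper_apply_diag {i j : l} (hij : i ≠ j) :
    d (longUpper i) (inl i) (inr i) = d (longUpper i) (inl i) (inl i) := by
  have h := congrArg (fun v => d v (inr i) (inr i)) (longUpper_weyl_cube (R := R) i)
  have hw : d (weyl i) = 0 := hrot _
  have h0 := hd.longUpper_apply_inr h2 hrot hij
  have hy : d (longUpper i * weyl i) = d (longUpper i) := by simp [hd.mul, hw]
  simp only [hd.mul_apply _ (longUpper i * weyl i), hy, longUpper_weyl_sq_row, hd.one] at h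
  simp [mul_row, longUpper_row, weyl_row, h0, hd.apply_comm _ (inr i) (inl i)] at h
  refine h2.mul_left_cancel ?_
  linear_combination -h

lemma exists_coboundary_long [Nontrivial l] : ∃ X : Matrix (l ⊕ l) (l ⊕ l) R, X.IsSymm ∧
    (∀ i, d (weyl i) = (weyl i).1 * X * (weyl i).1ᵀ - X) ∧
    (∀ i, d (longUpper i) = (longUpper i).1 * X * (longUpper i).1ᵀ - X) := by
  set a : l → R := fun i => d (longUpper i) (inl i) (inl i) with ha
  refine ⟨diagonal (Sum.elim a a), isSymm_diagonal _, fun i => ?_, fun i => ?_⟩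
  · rw [show d (weyl i) = 0 from hrot _]
    ext x y
    rw [Matrix.sub_apply, congr_apply]
    rcases x with x | x <;> rcases y with y | y <;> by_cases hx : x = i <;> by_cases hy : y = i <;>
      simp_all [weyl_row, diagonal_apply, eq_comm]
  · obtain ⟨j, hj⟩ := exists_ne i
    have h0 := hd.longUpper_apply_inr h2 hrot hj.symm
    have h1 := hd.longUpper_apply_diag h2 hrot hj.symm
    have h1' := hd.apply_comm (longUpper i) (inr i) (inl i)
    have hl (k) (hk : k ≠ i) (y) := hd.longUpper_apply_of_ne h2 hrot hk.symm (Or.inl rfl) y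
    have hr (k) (hk : k ≠ i) (y) := hd.longUpper_apply_of_ne h2 hrot hk.symm (Or.inr rfl) y
    have hl' (k) (hk : k ≠ i) (y) := (hd.apply_comm _ _ _).trans (hl k hk y)
    have hr' (k) (hk : k ≠ i) (y) := (hd.apply_comm _ _ _).trans (hr k hk y)
    ext x y
    rw [Matrix.sub_apply, congr_apply]
    rcases x with x | x <;> rcases y with y | y <;> by_cases hx : x = i <;> by_cases hy : y = i <;>
      simp [longUpper_row, diagonal_apply, hx, hy, hl, hr, hl', hr', h0, h1, h1',
        eq_comm (a := i) (b := y), a]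

end normalized

section longVanishing

variable (hd : IsCocycle d) (h2 : IsUnit (2 : R)) (hw : ∀ i, d (weyl i) = 0)
  (hU : ∀ i, d (longUpper i) = 0)

include hd hw hU in
lemma longLower_eq_zero (i : l) : d (longLower i) = 0 := by
  have h : (longLower i : symplecticGroup l R) = weyl i * longUpper i * (weyl i)⁻¹ := by
    rw [weyl_longUpper, mul_inv_cancel_right]
  rw [← hd.mem_ker, h]
  exact mul_mem (mul_mem (hw i) (hU i)) (inv_mem (hw i))

include hd hw in
lemma halfTurn_eq_zero (i : l) : d (halfTurn i) = 0 := by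
  have h : (halfTurn i : symplecticGroup l R) = weyl i * weyl i := by
    rw [halfTurn, weyl, ← map_mul, ← ofAdd_add, ← Pi.single_add]
    rfl
  rw [← hd.mem_ker, h]
  exact mul_mem (hw i) (hw i)

include hd h2 hU in
lemma short_apply_inr {i j : l} (hij : i ≠ j) {k : l} (hk : k ≠ j) (y : l ⊕ l) :
    d (short i j hij) (inr k) y = 0 := by
  refine row_inr_eq_zero h2 (hd.symm _) k (hd.bil_eq_of_mul_eq (hU k) (hU k) ?_) y
  rcases eq_or_ne k i with rfl | hki
  · exact longUpper_short_comm k j hij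
  · exact longUpper_short_comm_of_ne i j k hij hki hk

include hd h2 hw hU

lemma short_apply_inl {i j : l} (hij : i ≠ j) {k : l} (hk : k ≠ i) (y : l ⊕ l) :
    d (short i j hij) (inl k) y = 0 := by
  have hL := hd.longLower_eq_zero hw hU
  refine row_inl_eq_zero h2 (hd.symm _) k (hd.bil_eq_of_mul_eq (hL k) (hL k) ?_) y
  rcases eq_or_ne k j with rfl | hkj
  · exact longLower_short_comm i k hij
  · exact longLower_short_comm_of_ne i j k hij hk hkj

lemma short_apply_inl_self {i j : l} (hij : i ≠ j) :
    d (short i j hij) (inl i) (inl i) = 0 := by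
  have h := congrArg (fun v => d v (inl i) (inl i)) (short_halfTurn_short (R := R) i j hij)
  have h0 := hd.short_apply_inl h2 hw hU hij hij.symm
  simp [hd.mul_apply, hd.halfTurn_eq_zero hw, mul_row, short_row, halfTurn_row, add_vecMul,
    hij.symm, h0, hd.apply_comm _ (inl i) (inl j)] at h
  exact h2.mul_left_cancel (by linear_combination h)

lemma short_apply_inr_self {i j : l} (hij : i ≠ j) :
    d (short i j hij) (inr j) (inr j) = 0 := by
  have h := congrArg (fun v => d v (inr j) (inr j)) (short_halfTurn_short (R := R) i j hij)
  have h0 := hd.short_apply_inr h2 hU hij hij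
  simp [hd.mul_apply, hd.halfTurn_eq_zero hw, mul_row, short_row, halfTurn_row, sub_vecMul,
    hij.symm, h0, hd.apply_comm _ (inr j) (inr i)] at h
  exact h2.mul_left_cancel (by linear_combination h)

lemma short_apply_mixed {i j : l} (hij : i ≠ j) :
    d (short i j hij) (inl i) (inr j) = 0 := by
  have h := congrArg (fun v => d v (inl i) (inl i)) (sumTransvection_mul_short (R := R) i j hij)
  have h' := congrArg (fun v => d v (inl i) (inl i))
    (sumTransvection_mul_short (R := R) j i hij.symm)
  have h0 := hd.short_apply_inr h2 hU hij hij
  have h0' := hd.short_apply_inr h2 hU hij.symm hij.symm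
  have h1 := hd.short_apply_inl h2 hw hU hij.symm hij
  simp only [sumTransvection_comm j i] at h'
  simp [hd.mul_apply, hU, sumTransvection_row, h0, h0', h1, hd.apply_comm _ (inl i) (inr i),
    hd.apply_comm _ (inr j) (inr i), hd.apply_comm _ (inl i) (inr j),
    hd.short_apply_inl_self h2 hw hU,
    hd.short_apply_inr_self h2 hw hU] at h h'
  refine h2.mul_left_cancel ?_
  linear_combination h - h' + h1 (inr i) + h0' (inr i)
    + hd.apply_comm (short j i hij.symm) (inr i) (inl i)
    + hd.apply_comm (short j i hij.symm) (inr i) (inr j)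
    + 2 * hd.apply_comm (short i j hij) (inl i) (inr j)

lemma short_eq_zero {i j : l} (hij : i ≠ j) : d (short i j hij) = 0 := by
  have hr (k) (hk : k ≠ j) (y) := hd.short_apply_inr h2 hU hij hk y
  have hl (k) (hk : k ≠ i) (y) := hd.short_apply_inl h2 hw hU hij hk y
  have hr' (k) (hk : k ≠ j) (y) := (hd.apply_comm _ _ _).trans (hr k hk y)
  have hl' (k) (hk : k ≠ i) (y) := (hd.apply_comm _ _ _).trans (hl k hk y)
  have h1 := hd.short_apply_inl_self h2 hw hU hij
  have h2' := hd.short_apply_inr_self h2 hw hU hij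
  have h3 := hd.short_apply_mixed h2 hw hU hij
  have h3' := (hd.apply_comm _ _ _).trans h3
  ext x y
  rcases x with x | x <;> rcases y with y | y <;> by_cases hx : x = i <;> by_cases hy : y = i <;>
    by_cases hx' : x = j <;> by_cases hy' : y = j <;> simp_all

end longVanishing

end IsCocycle

/-- The matrix of the symplectic transvection along `v`. -/
def transvectionMatrix (v : l ⊕ l → R) : Matrix (l ⊕ l) (l ⊕ l) R :=
  1 + vecMulVec v (v ᵥ* paperJ l R)

lemma mul_transvectionMatrix (u : symplecticGroup l R) (v : l ⊕ l → R) :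
    u.1 * transvectionMatrix v = transvectionMatrix (u.1 *ᵥ v) * u.1 := by
  have hu := (mem_symplecticGroup_iff_paper u.1).mp u.2
  rw [transvectionMatrix, transvectionMatrix, Matrix.mul_add, Matrix.add_mul, Matrix.mul_one,
    Matrix.one_mul, mul_vecMulVec, vecMulVec_mul, ← vecMul_transpose, vecMul_vecMul, vecMul_vecMul,
    ← Matrix.mul_assoc, hu]

lemma longUpper_eq_transvectionMatrix (i : l) :
    (longUpper i : symplecticGroup l R).1 = transvectionMatrix (Pi.single (inl i) 1) := by
  refine ext_rows fun x => ?_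
  ext y
  rw [longUpper_row]
  rcases x with x | x <;> rcases y with y | y <;> by_cases hx : x = i <;> by_cases hy : y = i <;>
    simp_all [transvectionMatrix, vecMulVec_apply, paperJ, Matrix.one_apply, Pi.single_apply,
      eq_comm]

lemma longLower_eq_transvectionMatrix (i : l) :
    (longLower i : symplecticGroup l R).1 = transvectionMatrix (Pi.single (inr i) 1) := by
  refine ext_rows fun x => ?_
  ext y
  rw [longLower_row]
  rcases x with x | x <;> rcases y with y | y <;> by_cases hx : x = i <;> by_cases hy : y = i <;>
    simp_all [transvectionMatrix, vecMulVec_apply, paperJ, Matrix.one_apply, Pi.single_apply,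
      eq_comm]

lemma mulVec_apply_row (M : Matrix (l ⊕ l) (l ⊕ l) R) (v : l ⊕ l → R) (x : l ⊕ l) :
    (M *ᵥ v) x = M x ⬝ᵥ v := rfl

/-- The transvection along `v` belongs to the subgroup `K`. -/
def HasTransvection (K : Subgroup (symplecticGroup l R)) (v : l ⊕ l → R) : Prop :=
  ∃ k ∈ K, k.1 = transvectionMatrix v

lemma coe_conj_eq_transvectionMatrix {v : l ⊕ l → R} {k : symplecticGroup l R}
    (hk : k.1 = transvectionMatrix v) (u : symplecticGroup l R) :
    (u * k * u⁻¹).1 = transvectionMatrix (u.1 *ᵥ v) := by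
  rw [Submonoid.coe_mul, Submonoid.coe_mul, hk, mul_transvectionMatrix, Matrix.mul_assoc,
    ← Submonoid.coe_mul, mul_inv_cancel, Submonoid.coe_one, Matrix.mul_one]

lemma hasTransvection_mulVec {K : Subgroup (symplecticGroup l R)} {u : symplecticGroup l R}
    (hu : u ∈ K) {v : l ⊕ l → R} : HasTransvection K (u.1 *ᵥ v) ↔ HasTransvection K v := by
  have key {u : symplecticGroup l R} (hu : u ∈ K) {v : l ⊕ l → R} (h : HasTransvection K v) :
      HasTransvection K (u.1 *ᵥ v) := by
    obtain ⟨k, hk, hkv⟩ := h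
    exact ⟨u * k * u⁻¹, mul_mem (mul_mem hu hk) (inv_mem hu), coe_conj_eq_transvectionMatrix hkv u⟩
  refine ⟨fun h => ?_, key hu⟩
  have := key (inv_mem hu) h
  rwa [mulVec_mulVec, ← Submonoid.coe_mul, inv_mul_cancel, Submonoid.coe_one, one_mulVec] at this

lemma longUpper_pow (i : l) (n : ℕ) : ((longUpper i : symplecticGroup l R) ^ n).1 =
    1 + (n : R) • vecMulVec (Pi.single (inl i) 1) (Pi.single (inl i) 1 ᵥ* paperJ l R) := by
  induction n with
  | zero => simp
  | succ n ih =>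
    rw [pow_succ, Submonoid.coe_mul, ih, longUpper_eq_transvectionMatrix, transvectionMatrix]
    have h0 : vecMulVec (Pi.single (inl i) 1 : l ⊕ l → R) (Pi.single (inl i) 1 ᵥ* paperJ l R) *
        vecMulVec (Pi.single (inl i) 1 : l ⊕ l → R) (Pi.single (inl i) 1 ᵥ* paperJ l R) = 0 := by
      rw [vecMulVec_mul_vecMulVec]
      simp [paperJ]
    simp only [Matrix.mul_add, Matrix.add_mul, Matrix.smul_mul, h0, Matrix.mul_one, Matrix.one_mul,
      smul_zero, Nat.cast_add, Nat.cast_one]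
    module

section euclid

variable {N : ℕ} [NeZero N] {K : Subgroup (symplecticGroup l (ZMod N))}

lemma hasTransvection_smul (hU : ∀ i, longUpper i ∈ K) (i : l) (a : ZMod N) :
    HasTransvection K (a • Pi.single (inl i) 1) := by
  refine ⟨longUpper i ^ (a * a).val, pow_mem (hU i) _, ?_⟩
  rw [longUpper_pow, ZMod.natCast_zmod_val, transvectionMatrix, smul_vecMul, smul_vecMulVec,
    vecMulVec_smul, smul_smul]

lemma hasTransvection_of_inr_eq_zero (hU : ∀ i, longUpper i ∈ K)
    (hs : ∀ i j hij, short i j hij ∈ K) (v : l ⊕ l → ZMod N) (hv : ∀ i, v (inr i) = 0) :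
    HasTransvection K v := by
  induction hn : ∑ i, (v (inl i)).val using Nat.strong_induction_on generalizing v with
  | _ n ih =>
  by_cases h : ∃ i j, i ≠ j ∧ v (inl i) ≠ 0 ∧ (v (inl i)).val ≤ (v (inl j)).val
  · obtain ⟨i, j, hij, hi, hle⟩ := h
    set v' := Function.update v (inl j) (v (inl j) - v (inl i)) with hv'
    have hvv : (short j i hij.symm : symplecticGroup l (ZMod N)).1 *ᵥ v' = v := by
      ext x
      rw [mulVec_apply_row, short_row]
      rcases x with x | x <;> by_cases hx : x = i <;> by_cases hx' : x = j <;>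
        simp_all [add_dotProduct, sub_dotProduct]
    rw [← hvv, hasTransvection_mulVec (hs _ _ _)]
    refine ih _ ?_ v' (by simp [hv', hv]) rfl
    rw [← hn]
    refine Finset.sum_lt_sum (fun k _ => ?_) ⟨j, Finset.mem_univ _, ?_⟩
    · by_cases hk : k = j
      · subst hk
        simp [hv', ZMod.val_sub hle]
      · simp [hv', hk]
    · have : 0 < (v (inl i)).val := ZMod.val_pos.mpr hi
      simp only [hv', Function.update_self, ZMod.val_sub hle]
      omega
  · push Not at h
    by_cases h0 : ∃ i, v (inl i) ≠ 0
    · obtain ⟨i, hi⟩ := h0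
      have hne (j : l) (hj : j ≠ i) : v (inl j) = 0 := by
        by_contra hj0
        exact absurd (h i j hj.symm hi) (not_lt.mpr (h j i hj hj0).le)
      convert hasTransvection_smul hU i (v (inl i)) using 1
      ext (x | x)
      · by_cases hx : x = i <;> simp [hx, hne]
      · simp [hv]
    · push Not at h0
      refine ⟨1, one_mem _, ?_⟩
      rw [show v = 0 from funext (by rintro (x | x) <;> simp [h0, hv])]
      simp [transvectionMatrix]

theorem hasTransvection (hw : ∀ i, weyl i ∈ K) (hU : ∀ i, longUpper i ∈ K)
    (hL : ∀ i, longLower i ∈ K) (hs : ∀ i j hij, short i j hij ∈ K) (v : l ⊕ l → ZMod N) :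
    HasTransvection K v := by
  induction hn : ∑ i, ((v (inl i)).val + 2 * (v (inr i)).val) using Nat.strong_induction_on
    generalizing v with
  | _ n ih =>
  by_cases h0 : ∀ i, v (inr i) = 0
  · exact hasTransvection_of_inr_eq_zero hU hs v h0
  push Not at h0
  obtain ⟨i, hi⟩ := h0
  have hpos : 0 < (v (inr i)).val := ZMod.val_pos.mpr hi
  have descend (u : symplecticGroup l (ZMod N)) (hu : u ∈ K)
      (hne : ∀ j ≠ i, (u.1 *ᵥ v) (inl j) = v (inl j) ∧ (u.1 *ᵥ v) (inr j) = v (inr j))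
      (hlt : ((u.1 *ᵥ v) (inl i)).val + 2 * ((u.1 *ᵥ v) (inr i)).val <
        (v (inl i)).val + 2 * (v (inr i)).val) : HasTransvection K v := by
    rw [← hasTransvection_mulVec hu]
    refine ih _ ?_ _ rfl
    rw [← hn]
    refine Finset.sum_lt_sum (fun k _ => ?_) ⟨i, Finset.mem_univ _, hlt⟩
    rcases eq_or_ne k i with rfl | hk
    · exact hlt.le
    · rw [(hne k hk).1, (hne k hk).2]
  by_cases hle : (v (inr i)).val ≤ (v (inl i)).val
  · set v' := Function.update v (inl i) (v (inl i) - v (inr i)) with hv'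
    have hvv : (longUpper i : symplecticGroup l (ZMod N)).1 *ᵥ v' = v := by
      ext x
      rw [mulVec_apply_row, longUpper_row]
      rcases x with x | x <;> by_cases hx : x = i <;> simp_all [add_dotProduct]
    have hvv' : ((longUpper i)⁻¹ : symplecticGroup l (ZMod N)).1 *ᵥ v = v' := by
      rw [← hvv, mulVec_mulVec, ← Submonoid.coe_mul, inv_mul_cancel, Submonoid.coe_one, one_mulVec]
    refine descend _ (inv_mem (hU i)) ?_ ?_
    · intro j hj
      rw [hvv']
      simp [hv', hj]
    · rw [hvv']
      simp only [hv', Function.update_self, ZMod.val_sub hle, ne_eq, reduceCtorEq,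
        not_false_eq_true, Function.update_of_ne]
      omega
  · push Not at hle
    by_cases hz : v (inl i) = 0
    · refine descend _ (hw i) ?_ ?_
      · intro j hj
        simp [mulVec_apply_row, weyl_row, hj]
      · simp [mulVec_apply_row, weyl_row, hz]
        omega
    · have hpos' : 0 < (v (inl i)).val := ZMod.val_pos.mpr hz
      refine descend _ (hL i) ?_ ?_
      · intro j hj
        simp [mulVec_apply_row, longLower_row, hj]
      · have hl : ((longLower i : symplecticGroup l (ZMod N)).1 *ᵥ v) (inl i) = v (inl i) := by
          simp [mulVec_apply_row, longLower_row]
        have hr : ((longLower i : symplecticGroup l (ZMod N)).1 *ᵥ v) (inr i) =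
            v (inr i) - v (inl i) := by
          simp [mulVec_apply_row, longLower_row, sub_dotProduct]
        rw [hl, hr, ZMod.val_sub hle.le]
        omega

end euclid

/-- Every cocycle with values in symmetric matrices is a coboundary. -/
theorem IsCocycle.exists_coboundary {N : ℕ} [NeZero N] (hN : Odd N) [Nontrivial l]
    {d : symplecticGroup l (ZMod N) → Matrix (l ⊕ l) (l ⊕ l) (ZMod N)} (hd : IsCocycle d) :
    ∃ X : Matrix (l ⊕ l) (l ⊕ l) (ZMod N), X.IsSymm ∧ ∀ u, d u = u.1 * X * u.1ᵀ - X := by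
  have h2 : IsUnit (2 : ZMod N) := by
    have := (ZMod.isUnit_iff_coprime 2 N).mpr (Nat.coprime_two_left.mpr hN)
    exact_mod_cast this
  have hcard : IsUnit (Fintype.card (Multiplicative (l → ZMod 4)) : ZMod N) := by
    have h4 : (4 : ZMod N) = 2 ^ 2 := by norm_num
    simp only [Fintype.card_multiplicative, Fintype.card_pi, ZMod.card, Finset.prod_const]
    push_cast
    rw [h4]
    exact (h2.pow 2).pow _
  obtain ⟨X, hX, hdX⟩ := hd.exists_coboundary_of_finite hcard rotation
  have hd₁ := hd.sub_coboundary hX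
  obtain ⟨Y, hY, hweyl, hlong⟩ := hd₁.exists_coboundary_long h2 fun z => by
    simp only [hdX z, sub_self]
  have hd₂ := hd₁.sub_coboundary hY
  set d₂ := fun u : symplecticGroup l (ZMod N) =>
    d u - (u.1 * X * u.1ᵀ - X) - (u.1 * Y * u.1ᵀ - Y) with hd₂_def
  have hw (i) : d₂ (weyl i) = 0 := sub_eq_zero.mpr (hweyl i)
  have hU (i) : d₂ (longUpper i) = 0 := sub_eq_zero.mpr (hlong i)
  have hT := hasTransvection (K := hd₂.ker) hw hU (hd₂.longLower_eq_zero hw hU)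
    fun i j hij => hd₂.short_eq_zero h2 hw hU hij
  have hfix (u k : symplecticGroup l (ZMod N)) (v) (hk : k.1 = transvectionMatrix v)
      (hk0 : d₂ k = 0) (x y) : bil (d₂ u⁻¹) (k.1 x) (k.1 y) = d₂ u⁻¹ x y := by
    obtain ⟨k', hk', hkv⟩ := hT (u.1 *ᵥ v)
    refine hd₂.bil_eq_of_mul_eq hk0 hk' ?_ x y
    have : k' = u * k * u⁻¹ :=
      Subtype.ext (hkv.trans (coe_conj_eq_transvectionMatrix hk u).symm)
    rw [this]
    group
  refine ⟨X + Y, hX.add hY, fun u => ?_⟩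
  have hzero : d₂ (u⁻¹)⁻¹ = 0 := eq_zero_of_long_fixed h2 (hd₂.symm _)
    (fun i => hfix u⁻¹ _ _ (longUpper_eq_transvectionMatrix i) (hU i))
    (fun i => hfix u⁻¹ _ _ (longLower_eq_transvectionMatrix i) (hd₂.longLower_eq_zero hw hU i))
  rw [inv_inv] at hzero
  have h : d u - (u.1 * X * u.1ᵀ - X) - (u.1 * Y * u.1ᵀ - Y) = 0 := hzero
  rw [sub_sub, sub_eq_zero] at h
  rw [h, Matrix.mul_add, Matrix.add_mul]
  abel

lemma paperJ_eq_neg_J : paperJ l R = -J l R := by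
  rw [paperJ, J, fromBlocks_neg]
  simp

lemma paperJ_mul_paperJ : paperJ l R * paperJ l R = -1 := by
  rw [paperJ_eq_neg_J, neg_mul_neg, J_squared]

lemma transpose_paperJ : (paperJ l R)ᵀ = -paperJ l R := by
  rw [paperJ_eq_neg_J, transpose_neg, J_transpose]

lemma mem_spLie_iff {X : Matrix (l ⊕ l) (l ⊕ l) R} :
    X ∈ spLie l R ↔ (X * paperJ l R).IsSymm := by
  have key : paperJ l R * (Xᵀ * paperJ l R + paperJ l R * X) * paperJ l R =
      (X * paperJ l R)ᵀ - X * paperJ l R := by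
    rw [transpose_mul, transpose_paperJ, Matrix.mul_add, Matrix.add_mul,
      ← Matrix.mul_assoc (paperJ l R) (paperJ l R), paperJ_mul_paperJ, ← Matrix.mul_assoc,
      Matrix.mul_assoc _ _ (paperJ l R), paperJ_mul_paperJ]
    simp [sub_eq_add_neg]
  change Xᵀ * paperJ l R + paperJ l R * X = 0 ↔ (X * paperJ l R)ᵀ = X * paperJ l R
  rw [← sub_eq_zero (b := X * paperJ l R), ← key]
  refine ⟨fun h => by simp [h], fun h => ?_⟩
  have h' := congrArg (fun Y => paperJ l R * Y * paperJ l R) h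
  simp only [Matrix.mul_assoc, paperJ_mul_paperJ] at h'
  simpa [← Matrix.mul_assoc, paperJ_mul_paperJ] using h'

lemma coe_inv_mul_paperJ (u : symplecticGroup l R) : u.1⁻¹ * paperJ l R = paperJ l R * u.1ᵀ := by
  have h := u.2
  rw [SymplecticGroup.mem_iff] at h
  have hu : IsUnit u.1.det := SymplecticGroup.symplectic_det u.2
  rw [paperJ_eq_neg_J, Matrix.mul_neg, Matrix.neg_mul, neg_inj]
  conv_lhs => rw [← h]
  rw [Matrix.mul_assoc, nonsing_inv_mul_cancel_left _ _ hu]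

end SpCohomology

/-- For every `g ≥ 3` and every odd `N ≥ 1`, the first group cohomology
`H¹(Sp_{2g}(ℤ/Nℤ), sp_{2g}(ℤ/Nℤ))` for the adjoint action vanishes.  Concretely: every
`1`-cocycle `c` (a map from the group to `sp_{2g}` with `c(uv) = c(u) + u·c(v)·u⁻¹`) is a
coboundary, i.e. of the form `c(u) = u·X·u⁻¹ − X` for some fixed `X ∈ sp_{2g}(ℤ/Nℤ)`. -/
theorem h1_adjoint_vanishes (g N : ℕ) (hg : 3 ≤ g) (hN : 1 ≤ N) (hNodd : Odd N)
    (c : ↥(Matrix.symplecticGroup (Fin g) (ZMod N)) →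
      Matrix (Fin g ⊕ Fin g) (Fin g ⊕ Fin g) (ZMod N))
    (hmem : ∀ u, c u ∈ spLie (Fin g) (ZMod N))
    (hcoc : ∀ u v, c (u * v) = c u + (u : Matrix _ _ (ZMod N)) * c v * (u : Matrix _ _ (ZMod N))⁻¹) :
    ∃ X ∈ spLie (Fin g) (ZMod N),
      ∀ u, c u = (u : Matrix _ _ (ZMod N)) * X * (u : Matrix _ _ (ZMod N))⁻¹ - X := by
  have : NeZero N := ⟨by omega⟩
  have : Nontrivial (Fin g) := Fin.nontrivial_iff_two_le.mpr (by omega)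
  have hd : SpCohomology.IsCocycle fun u => c u * paperJ (Fin g) (ZMod N) :=
    { symm := fun u => SpCohomology.mem_spLie_iff.mp (hmem u)
      mul := fun u v => by
        rw [hcoc, Matrix.add_mul, Matrix.mul_assoc _ _ (paperJ _ _),
          SpCohomology.coe_inv_mul_paperJ]
        simp only [Matrix.mul_assoc] }
  obtain ⟨S, hS, hc⟩ := hd.exists_coboundary hNodd
  refine ⟨-(S * paperJ _ _), SpCohomology.mem_spLie_iff.mpr ?_, fun u => ?_⟩
  · rwa [Matrix.neg_mul, Matrix.mul_assoc, SpCohomology.paperJ_mul_paperJ, Matrix.mul_neg,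
      Matrix.mul_one, neg_neg]
  · have hinj : Function.Injective (· * paperJ (Fin g) (ZMod N)) :=
      Function.LeftInverse.injective (g := (-· * paperJ (Fin g) (ZMod N))) fun Y => by
        simp [Matrix.mul_assoc, SpCohomology.paperJ_mul_paperJ]
    refine hinj ((hc u).trans ?_)
    simp only [Matrix.mul_assoc, Matrix.sub_mul, Matrix.neg_mul, Matrix.mul_neg,
      SpCohomology.paperJ_mul_paperJ, SpCohomology.coe_inv_mul_paperJ]
    simp only [← Matrix.mul_assoc (paperJ _ _), SpCohomology.paperJ_mul_paperJ]
    simp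
end

section
/- Let g ≥ 3 and let p be an odd prime. If φ : sp_{2g}(ℤ/pℤ) → ℤ/pℤ is a ℤ/pℤ-linear map invariant under the coadjoint action, i.e. φ(u·X·u⁻¹) = φ(X) for every u ∈ Sp_{2g}(ℤ/pℤ) and every X ∈ sp_{2g}(ℤ/pℤ), then φ = 0. -/
open Matrix

section

variable {l R : Type*} [DecidableEq l] [Fintype l] [CommRing R]

theorem fromBlocks_mem_spLie_iff {A B C D : Matrix l l R} :
    fromBlocks A B C D ∈ spLie l R ↔ B.IsSymm ∧ C.IsSymm ∧ D = -Aᵀ := by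
  change (fromBlocks A B C D)ᵀ * paperJ l R + paperJ l R * fromBlocks A B C D = 0 ↔ _
  rw [← fromBlocks_zero, paperJ, fromBlocks_transpose, fromBlocks_multiply, fromBlocks_multiply,
    fromBlocks_add, fromBlocks_inj]
  simp only [Matrix.mul_zero, Matrix.zero_mul, Matrix.mul_one, Matrix.one_mul, Matrix.mul_neg,
    Matrix.neg_mul, zero_add, add_zero, Matrix.IsSymm]
  constructor
  · rintro ⟨hC, hD, -, hB⟩
    exact ⟨(sub_eq_zero.1 (by rwa [sub_eq_add_neg])), (neg_add_eq_zero.1 hC),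
      eq_neg_of_add_eq_zero_right hD⟩
  · rintro ⟨hB, hC, rfl⟩
    simp [hB, hC]

/-- The element `[[A, B], [C, -ᵀA]]` of `sp`, for symmetric `B` and `C`. -/
def spLieMk (A B C : Matrix l l R) (hB : B.IsSymm) (hC : C.IsSymm) : spLie l R :=
  ⟨fromBlocks A B C (-Aᵀ), fromBlocks_mem_spLie_iff.2 ⟨hB, hC, rfl⟩⟩

theorem exists_eq_spLieMk (X : spLie l R) :
    ∃ A B C, ∃ (hB : B.IsSymm) (hC : C.IsSymm), X = spLieMk A B C hB hC := by
  obtain ⟨X, hX⟩ := X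
  rw [← fromBlocks_toBlocks X, fromBlocks_mem_spLie_iff] at hX
  refine ⟨X.toBlocks₁₁, X.toBlocks₁₂, X.toBlocks₂₁, hX.1, hX.2.1, Subtype.ext ?_⟩
  simp only [spLieMk]
  rw [← hX.2.2, fromBlocks_toBlocks]

theorem spLieMk_add {A B C A' B' C' : Matrix l l R} (hB : B.IsSymm) (hC : C.IsSymm)
    (hB' : B'.IsSymm) (hC' : C'.IsSymm) :
    spLieMk A B C hB hC + spLieMk A' B' C' hB' hC' =
      spLieMk (A + A') (B + B') (C + C') (hB.add hB') (hC.add hC') :=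
  Subtype.ext <| by
    simp [spLieMk, fromBlocks_add, add_comm]

theorem upperUnipotent_mem_symplecticGroup {S : Matrix l l R} (hS : S.IsSymm) :
    fromBlocks 1 S 0 1 ∈ symplecticGroup l R := by
  rw [mem_symplecticGroup_iff_paper, paperJ]
  simp [fromBlocks_transpose, fromBlocks_multiply, hS.eq]

theorem lowerUnipotent_mem_symplecticGroup {S : Matrix l l R} (hS : S.IsSymm) :
    fromBlocks 1 0 S 1 ∈ symplecticGroup l R := by
  rw [mem_symplecticGroup_iff_paper, paperJ]
  simp [fromBlocks_transpose, fromBlocks_multiply, hS.eq]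

theorem inv_upperUnipotent (S : Matrix l l R) :
    (fromBlocks 1 S 0 1 : Matrix (l ⊕ l) (l ⊕ l) R)⁻¹ = fromBlocks 1 (-S) 0 1 :=
  inv_eq_right_inv <| by simp [fromBlocks_multiply]

theorem inv_lowerUnipotent (S : Matrix l l R) :
    (fromBlocks 1 0 S 1 : Matrix (l ⊕ l) (l ⊕ l) R)⁻¹ = fromBlocks 1 0 (-S) 1 :=
  inv_eq_right_inv <| by simp [fromBlocks_multiply]

/-- The additive group of square matrices is generated by products of two symmetric matrices. -/
theorem matrix_induction_symm_mul_symm {P : Matrix l l R → Prop} (A : Matrix l l R)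
    (zero : P 0) (add : ∀ A B, P A → P B → P (A + B))
    (mul : ∀ S C : Matrix l l R, S.IsSymm → C.IsSymm → P (S * C)) : P A := by
  refine Matrix.induction_on' A zero add fun i j c => ?_
  by_cases hij : i = j
  · subst hij
    simpa using mul (single i i 1) (single i i c) (by simp [Matrix.IsSymm])
      (by simp [Matrix.IsSymm])
  · have h := mul (single i i 1) (single i j c + single j i c) (by simp [Matrix.IsSymm])
      (by simp [Matrix.IsSymm, add_comm])
    rwa [Matrix.mul_add, single_mul_single_same, single_mul_single_of_ne _ _ _ _ hij,
      one_mul, add_zero] at h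

/-- When `2` is invertible, every functional on `sp` invariant under the adjoint action of the
symplectic group vanishes. -/
theorem spLie_invariant_functional_eq_zero (h2 : IsUnit (2 : R)) (φ : spLie l R →ₗ[R] R)
    (hinv : ∀ u ∈ symplecticGroup l R, ∀ X Y : spLie l R,
      (Y : Matrix (l ⊕ l) (l ⊕ l) R) = u * (X : Matrix _ _ R) * u⁻¹ → φ Y = φ X) :
    φ = 0 := by
  have isSymm_zero : (0 : Matrix l l R).IsSymm := Matrix.isSymm_zero
  have halve : ∀ S : Matrix l l R, S.IsSymm → ∃ T : Matrix l l R, T.IsSymm ∧ T + T = S := by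
    intro S hS
    obtain ⟨c, hc⟩ := h2.exists_right_inv
    refine ⟨c • S, hS.smul c, ?_⟩
    rw [← add_smul, ← two_mul, hc, one_smul]
  have hupper : ∀ B (hB : B.IsSymm), φ (spLieMk 0 B 0 hB isSymm_zero) = 0 := by
    intro B hB
    obtain ⟨T, hT, rfl⟩ := halve B hB
    have h := hinv _ (upperUnipotent_mem_symplecticGroup hT.neg)
      (spLieMk 1 0 0 isSymm_zero isSymm_zero) (spLieMk 1 (T + T) 0 hB isSymm_zero) (by
        rw [inv_upperUnipotent]
        simp [spLieMk, fromBlocks_multiply])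
    have h' := spLieMk_add (A := 1) (A' := 0) isSymm_zero isSymm_zero hB isSymm_zero
    simp only [add_zero, zero_add] at h'
    rwa [← h', map_add, add_eq_left] at h
  have hlower : ∀ C (hC : C.IsSymm), φ (spLieMk 0 0 C isSymm_zero hC) = 0 := by
    intro C hC
    obtain ⟨T, hT, rfl⟩ := halve C hC
    have h := hinv _ (lowerUnipotent_mem_symplecticGroup hT)
      (spLieMk 1 0 0 isSymm_zero isSymm_zero) (spLieMk 1 0 (T + T) isSymm_zero hC) (by
        rw [inv_lowerUnipotent]
        simp [spLieMk, fromBlocks_multiply])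
    have h' := spLieMk_add (A := 1) (A' := 0) isSymm_zero isSymm_zero isSymm_zero hC
    simp only [add_zero, zero_add] at h'
    rwa [← h', map_add, add_eq_left] at h
  have hsplit : ∀ A B C (hB : B.IsSymm) (hC : C.IsSymm), φ (spLieMk A B C hB hC) =
      φ (spLieMk A 0 0 isSymm_zero isSymm_zero) := by
    intro A B C hB hC
    have h := spLieMk_add (A := A) (A' := 0) isSymm_zero isSymm_zero hB isSymm_zero
    have h' := spLieMk_add (A := A) (A' := 0) hB isSymm_zero isSymm_zero hC
    simp only [add_zero, zero_add] at h h'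
    rw [← h', map_add, hlower, ← h, map_add, hupper, add_zero, add_zero]
  have hdiag : ∀ A, φ (spLieMk A 0 0 isSymm_zero isSymm_zero) = 0 := by
    intro A
    induction A using matrix_induction_symm_mul_symm with
    | zero => exact hupper 0 isSymm_zero
    | add A B hA hB =>
      have h := spLieMk_add (A := A) (A' := B) isSymm_zero isSymm_zero isSymm_zero isSymm_zero
      simp only [add_zero] at h
      rw [← h, map_add, hA, hB, add_zero]
    | mul S C hS hC =>
      have hSCS : (-(S * C * S)).IsSymm := by
        simp [Matrix.IsSymm, hS.eq, hC.eq, Matrix.mul_assoc]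
      rw [← hsplit _ _ _ hSCS hC, ← hlower C hC]
      refine hinv _ (upperUnipotent_mem_symplecticGroup hS) _ _ ?_
      rw [inv_upperUnipotent]
      simp [spLieMk, fromBlocks_multiply, hS.eq, hC.eq]
  ext X
  obtain ⟨A, B, C, hB, hC, rfl⟩ := exists_eq_spLieMk X
  rw [hsplit, hdiag, LinearMap.zero_apply]

end

/-- Let `g ≥ 3` and `p` an odd prime.  Every `ℤ/pℤ`-linear functional
`φ : sp_{2g}(ℤ/pℤ) → ℤ/pℤ` invariant under the coadjoint action (i.e. `φ(u·X·u⁻¹) = φ(X)`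
for all `u ∈ Sp_{2g}(ℤ/pℤ)` and `X ∈ sp_{2g}(ℤ/pℤ)`) is zero. -/
theorem coadjoint_invariant_functional_eq_zero (g p : ℕ) (hg : 3 ≤ g) (hp : p.Prime)
    (hpodd : Odd p)
    (φ : ↥(spLie (Fin g) (ZMod p)) →ₗ[ZMod p] ZMod p)
    (hinv : ∀ u ∈ Matrix.symplecticGroup (Fin g) (ZMod p),
      ∀ X Y : ↥(spLie (Fin g) (ZMod p)),
        (Y : Matrix (Fin g ⊕ Fin g) (Fin g ⊕ Fin g) (ZMod p)) = u * (X : Matrix _ _ (ZMod p)) * u⁻¹ →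
          φ Y = φ X) :
    φ = 0 := by
  have : Fact p.Prime := ⟨hp⟩
  refine spLie_invariant_functional_eq_zero (IsUnit.mk0 _ ?_) φ hinv
  have h : ((2 : ℕ) : ZMod p) ≠ 0 := by
    rw [Ne, ZMod.natCast_eq_zero_iff, Nat.prime_dvd_prime_iff_eq hp Nat.prime_two]
    rintro rfl
    exact absurd hpodd (by decide)
  exact_mod_cast h
end

section
/- Let g ≥ 3 and let p be an odd prime. If B : sp_{2g}(ℤ/pℤ) × sp_{2g}(ℤ/pℤ) → ℤ/pℤ is an alternating ℤ/pℤ-bilinear form invariant under the adjoint action, i.e. B(u·X·u⁻¹, u·Y·u⁻¹) = B(X, Y) for every u ∈ Sp_{2g}(ℤ/pℤ) and all X, Y ∈ sp_{2g}(ℤ/pℤ), then B = 0. -/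
open Matrix

section SymplecticSquares

variable {l R : Type*} [DecidableEq l] [Fintype l] [CommRing R]

theorem paperJ_mul_self : paperJ l R * paperJ l R = -1 := by
  simp [paperJ, Matrix.fromBlocks_multiply, ← Matrix.fromBlocks_one, Matrix.fromBlocks_neg]

theorem paperJ_transpose {l : Type*} [DecidableEq l] : (paperJ l R)ᵀ = -paperJ l R := by
  simp [paperJ, Matrix.fromBlocks_transpose, Matrix.fromBlocks_neg]

/-- The standard symplectic pairing `ω(v, w) = ᵀv·J·w`. -/
def sympForm (v w : l ⊕ l → R) : R := v ⬝ᵥ (paperJ l R *ᵥ w)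

theorem sympForm_swap (v w : l ⊕ l → R) : sympForm v w = -sympForm w v := by
  rw [sympForm, sympForm, Matrix.dotProduct_mulVec, ← Matrix.mulVec_transpose, paperJ_transpose,
    Matrix.neg_mulVec, neg_dotProduct, dotProduct_comm]

theorem sympForm_add_right (v w z : l ⊕ l → R) :
    sympForm v (w + z) = sympForm v w + sympForm v z := by
  simp [sympForm, Matrix.mulVec_add]

theorem sympForm_sub_right (v w z : l ⊕ l → R) :
    sympForm v (w - z) = sympForm v w - sympForm v z := by
  simp [sympForm, Matrix.mulVec_sub]

theorem sympForm_self [NoZeroDivisors R] (h2 : (2 : R) ≠ 0) (v : l ⊕ l → R) :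
    sympForm v v = 0 := by
  have h : 2 * sympForm v v = 0 := by linear_combination sympForm_swap v v
  exact (mul_eq_zero.mp h).resolve_left h2

theorem exists_sympForm_ne_zero {v : l ⊕ l → R} (hv : v ≠ 0) : ∃ z, sympForm v z ≠ 0 := by
  obtain ⟨i, hi⟩ := Function.ne_iff.mp hv
  refine ⟨-(paperJ l R *ᵥ Pi.single i 1), ?_⟩
  rw [sympForm, Matrix.mulVec_neg, Matrix.mulVec_mulVec, paperJ_mul_self, Matrix.neg_mulVec,
    neg_neg, Matrix.one_mulVec, dotProduct_single_one]
  exact hi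

/-- The element `x ↦ ω(v, x) v` of `sp_{2g}`. -/
def spSquare (v : l ⊕ l → R) : spLie l R :=
  ⟨vecMulVec v v * paperJ l R, by
    change (_ : Matrix _ _ R) = 0
    rw [Matrix.transpose_mul, paperJ_transpose, Matrix.transpose_vecMulVec]
    simp [Matrix.mul_assoc]⟩

theorem spSquare_zero : spSquare (0 : l ⊕ l → R) = 0 := by
  ext1; simp [spSquare]

theorem spSquare_neg (v : l ⊕ l → R) : spSquare (-v) = spSquare v := by
  ext1; simp [spSquare]

theorem spSquare_add_add_spSquare_sub (v w : l ⊕ l → R) :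
    spSquare (v + w) + spSquare (v - w) = (2 : R) • spSquare v + (2 : R) • spSquare w := by
  ext1
  simp only [spSquare, Submodule.coe_add, Submodule.coe_smul, ← Matrix.add_mul,
    ← Matrix.smul_mul]
  congr 1
  ext i j
  simp [vecMulVec_apply]
  ring

theorem coe_spSquare_mulVec {u : Matrix (l ⊕ l) (l ⊕ l) R} (hu : u ∈ symplecticGroup l R)
    (v : l ⊕ l → R) :
    (spSquare (u *ᵥ v) : Matrix (l ⊕ l) (l ⊕ l) R) = u * (spSquare v : Matrix _ _ R) * u⁻¹ := by
  have hdet : IsUnit u.det := SymplecticGroup.symplectic_det hu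
  have hJ : paperJ l R * u⁻¹ = uᵀ * paperJ l R := by
    rw [← (mem_symplecticGroup_iff_paper u).mp hu, Matrix.mul_nonsing_inv_cancel_right _ _ hdet,
      (mem_symplecticGroup_iff_paper u).mp hu]
  simp only [spSquare]
  rw [Matrix.mul_assoc u, Matrix.mul_assoc (vecMulVec v v), hJ, ← Matrix.mul_assoc,
    ← Matrix.mul_assoc, Matrix.mul_vecMulVec, Matrix.vecMulVec_mul _ _ uᵀ,
    Matrix.vecMul_transpose]

/-- The symplectic transvection `x ↦ x + c ω(v, x) v`. -/
def sympTransvection (c : R) (v : l ⊕ l → R) : Matrix (l ⊕ l) (l ⊕ l) R :=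
  1 + c • (vecMulVec v v * paperJ l R)

theorem vecMulVec_mul_paperJ_mulVec (v x : l ⊕ l → R) :
    (vecMulVec v v * paperJ l R) *ᵥ x = sympForm v x • v := by
  rw [← Matrix.mulVec_mulVec, Matrix.vecMulVec_mulVec]
  simp [sympForm]

theorem sympTransvection_mulVec (c : R) (v x : l ⊕ l → R) :
    sympTransvection c v *ᵥ x = x + (c * sympForm v x) • v := by
  rw [sympTransvection, Matrix.add_mulVec, Matrix.one_mulVec, Matrix.smul_mulVec,
    vecMulVec_mul_paperJ_mulVec, smul_smul]

theorem sympTransvection_mem {v : l ⊕ l → R} (hv : sympForm v v = 0) (c : R) :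
    sympTransvection c v ∈ symplecticGroup l R := by
  rw [mem_symplecticGroup_iff_paper]
  have h : vecMulVec v v * (paperJ l R * vecMulVec v v) = 0 := by
    rw [Matrix.mul_vecMulVec, Matrix.vecMulVec_mul_vecMulVec]
    change vecMulVec v (sympForm v v • v) = 0
    simp [hv]
  have h' : paperJ l R * (vecMulVec v v * (paperJ l R * (vecMulVec v v * paperJ l R))) = 0 := by
    rw [← Matrix.mul_assoc (paperJ l R) (vecMulVec v v) (paperJ l R),
      ← Matrix.mul_assoc (vecMulVec v v), h, Matrix.zero_mul, Matrix.mul_zero]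
  simp only [sympTransvection, Matrix.transpose_add, Matrix.transpose_one, Matrix.transpose_smul,
    Matrix.transpose_mul, paperJ_transpose, Matrix.transpose_vecMulVec]
  simp [Matrix.add_mul, Matrix.mul_add, Matrix.mul_assoc, h']

theorem mul_paperJ_symm_of_mem_spLie {X : Matrix (l ⊕ l) (l ⊕ l) R} (hX : X ∈ spLie l R) :
    (X * paperJ l R)ᵀ = X * paperJ l R := by
  have h : Xᵀ * paperJ l R = -(paperJ l R * X) := eq_neg_of_add_eq_zero_left hX
  have h' := congrArg (fun M => paperJ l R * M * paperJ l R) h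
  simp only [Matrix.mul_assoc, paperJ_mul_self, Matrix.mul_neg, Matrix.neg_mul,
    Matrix.mul_one] at h'
  rw [← Matrix.mul_assoc, paperJ_mul_self] at h'
  rw [Matrix.transpose_mul, paperJ_transpose, Matrix.neg_mul]
  simpa using h'

end SymplecticSquares

section Field

variable {l K : Type*} [DecidableEq l] [Fintype l] [Field K]

theorem span_range_spSquare (h2 : (2 : K) ≠ 0) :
    Submodule.span K (Set.range (spSquare : (l ⊕ l → K) → spLie l K)) = ⊤ := by
  rw [eq_top_iff]
  rintro X -
  let N : Matrix (l ⊕ l) (l ⊕ l) K := X * paperJ l K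
  have hN : Nᵀ = N := mul_paperJ_symm_of_mem_spLie X.2
  have hXN : (X : Matrix (l ⊕ l) (l ⊕ l) K) = -N * paperJ l K := by
    simp [N, Matrix.mul_assoc, paperJ_mul_self]
  let e : l ⊕ l → l ⊕ l → K := fun i => Pi.single i 1
  have hX : X = -(2 : K)⁻¹ • ∑ i, ∑ j, N i j •
      (spSquare (e i + e j) - spSquare (e i) - spSquare (e j)) := by
    ext1
    rw [hXN]
    simp only [spSquare, Submodule.coe_smul, AddSubmonoidClass.coe_finsetSum,
      AddSubgroupClass.coe_sub, ← Matrix.sub_mul, ← Matrix.smul_mul, ← Matrix.sum_mul]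
    congr 1
    have hpol : ∀ i j, vecMulVec (e i + e j) (e i + e j) - vecMulVec (e i) (e i)
        - vecMulVec (e j) (e j) = Matrix.single i j (1 : K) + Matrix.single j i 1 := by
      intro i j
      simp only [e, Matrix.vecMulVec_add, Matrix.add_vecMulVec,
        ← Matrix.single_eq_single_vecMulVec_single]
      abel
    have hsum : ∑ i, ∑ j, N i j • Matrix.single j i (1 : K) = N := by
      conv_rhs => rw [← hN, Matrix.matrix_eq_sum_single Nᵀ, Finset.sum_comm]
      simp
    have hsum' : ∑ i, ∑ j, N i j • Matrix.single i j (1 : K) = N := by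
      conv_rhs => rw [Matrix.matrix_eq_sum_single N]
      simp
    simp_rw [hpol, smul_add, Finset.sum_add_distrib]
    rw [hsum, hsum', ← two_smul K N, smul_smul]
    simp [h2]
  rw [hX]
  have hmem : ∀ v : l ⊕ l → K, spSquare v ∈ Submodule.span K (Set.range spSquare) :=
    fun v => Submodule.subset_span ⟨v, rfl⟩
  exact Submodule.smul_mem _ _ <| Submodule.sum_mem _ fun i _ => Submodule.sum_mem _ fun j _ =>
    Submodule.smul_mem _ _ <| Submodule.sub_mem _ (Submodule.sub_mem _ (hmem _) (hmem _)) (hmem _)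

variable {B : spLie l K →ₗ[K] spLie l K →ₗ[K] K}

/-- Three transvections carry the pair `(v, w)` to `(w, -v)` when `ω(v, w) ≠ 0`. -/
theorem apply_spSquare_comm (h2 : (2 : K) ≠ 0)
    (hinv : ∀ u ∈ symplecticGroup l K, ∀ v w,
      B (spSquare (u *ᵥ v)) (spSquare (u *ᵥ w)) = B (spSquare v) (spSquare w))
    {v w : l ⊕ l → K} (hvw : sympForm v w ≠ 0) :
    B (spSquare v) (spSquare w) = B (spSquare w) (spSquare v) := by
  have hvv := sympForm_self h2 v
  have hww := sympForm_self h2 w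
  have hwv : sympForm w v = -sympForm v w := sympForm_swap w v
  set c : K := -(sympForm v w)⁻¹
  have hv := fun x y => hinv _ (sympTransvection_mem hvv c) x y
  have hw := fun x y => hinv _ (sympTransvection_mem hww c) x y
  simp only [sympTransvection_mulVec] at hv hw
  have hc : c * sympForm v w = -1 := by simp [c, hvw]
  have hc' : c * sympForm w v = 1 := by rw [hwv, mul_neg, hc, neg_neg]
  have hshear := hv v w
  have hswap := hw v (w - v)
  have hunshear := hv (v + w) (-v)
  have hneg : sympForm v (-v) = 0 := by
    rw [sympForm, Matrix.mulVec_neg, dotProduct_neg, ← sympForm, hvv, neg_zero]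
  simp only [sympForm_sub_right, sympForm_add_right, hvv, hww, hc, hc', hneg, mul_zero, zero_smul,
    add_zero, zero_add, zero_sub, neg_smul, one_smul, mul_neg] at hshear hswap hunshear
  rw [← sub_eq_add_neg] at hshear
  rw [← sub_eq_add_neg, sub_sub_cancel_left] at hswap
  rw [← sub_eq_add_neg, add_sub_cancel_left] at hunshear
  rw [← hshear, ← hswap, ← hunshear, spSquare_neg]

theorem invariant_alternating_eq_zero (h2 : (2 : K) ≠ 0) (halt : ∀ X, B X X = 0)
    (hinv : ∀ u ∈ symplecticGroup l K, ∀ v w,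
      B (spSquare (u *ᵥ v)) (spSquare (u *ᵥ w)) = B (spSquare v) (spSquare w)) :
    B = 0 := by
  have hgen : ∀ v w, sympForm v w ≠ 0 → B (spSquare v) (spSquare w) = 0 := by
    intro v w hvw
    have hcomm := apply_spSquare_comm h2 hinv hvw
    have hskew := halt (spSquare v + spSquare w)
    simp only [map_add, LinearMap.add_apply, halt, zero_add, add_zero] at hskew
    rw [← hcomm, ← two_mul] at hskew
    exact (mul_eq_zero.mp hskew).resolve_left h2
  have hall : ∀ v w, B (spSquare v) (spSquare w) = 0 := by
    intro v w
    by_cases hvw : sympForm v w = 0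
    · rcases eq_or_ne v 0 with rfl | hv
      · simp [spSquare_zero]
      · obtain ⟨z, hz⟩ := exists_sympForm_ne_zero hv
        have hadd := hgen v (w + z) (by simpa [sympForm_add_right, hvw] using hz)
        have hsub := hgen v (w - z) (by simpa [sympForm_sub_right, hvw] using hz)
        have h := congrArg (B (spSquare v)) (spSquare_add_add_spSquare_sub w z)
        simp only [map_add, map_smul, hadd, hsub, hgen v z hz, smul_eq_mul, mul_zero,
          add_zero] at h
        exact (mul_eq_zero.mp h.symm).resolve_left h2
    · exact hgen v w hvw
  refine LinearMap.ext_on_range (span_range_spSquare h2) fun v => ?_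
  exact LinearMap.ext_on_range (span_range_spSquare h2) fun w => by simpa using hall v w

end Field

/-- Let `g ≥ 3` and `p` an odd prime.  Every alternating `ℤ/pℤ`-bilinear form
`B` on `sp_{2g}(ℤ/pℤ)` invariant under the adjoint action (`B(u·X·u⁻¹, u·Y·u⁻¹) = B(X, Y)` for
all `u ∈ Sp_{2g}(ℤ/pℤ)`) is zero. -/
theorem adjoint_invariant_alternating_eq_zero (g p : ℕ) (hg : 3 ≤ g) (hp : p.Prime)
    (hpodd : Odd p)
    (B : ↥(spLie (Fin g) (ZMod p)) →ₗ[ZMod p] ↥(spLie (Fin g) (ZMod p)) →ₗ[ZMod p] ZMod p)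
    (halt : ∀ X, B X X = 0)
    (hinv : ∀ u ∈ Matrix.symplecticGroup (Fin g) (ZMod p),
      ∀ X Y X' Y' : ↥(spLie (Fin g) (ZMod p)),
        (X' : Matrix (Fin g ⊕ Fin g) (Fin g ⊕ Fin g) (ZMod p)) = u * (X : Matrix _ _ (ZMod p)) * u⁻¹ →
        (Y' : Matrix (Fin g ⊕ Fin g) (Fin g ⊕ Fin g) (ZMod p)) = u * (Y : Matrix _ _ (ZMod p)) * u⁻¹ →
          B X' Y' = B X Y) :
    B = 0 := by
  have : Fact p.Prime := ⟨hp⟩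
  have h2 : (2 : ZMod p) ≠ 0 := by
    refine Ring.two_ne_zero ?_
    rw [ZMod.ringChar_zmod_n]
    rintro rfl
    exact absurd hpodd (by decide)
  exact invariant_alternating_eq_zero h2 halt fun u hu v w =>
    hinv u hu _ _ _ _ (coe_spSquare_mulVec hu v) (coe_spSquare_mulVec hu w)
end
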